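/- Let η ∈ (0,1], let f satisfy Hypothesis (H2) with constants α ∈ (0,1) and κ > 0, let V₁, V₂ be Lipschitz on [0,L], and let (ρ₁,ρ₂) be a classical solution of the viscous system with σ > 0 on [0,T]×[0,L] such that ρ₁(t,·) and ρ₂(t,·) are probability densities for every t ∈ [0,T]. Then there exist constants Λ₁, Λ₂ > 0, depending only on α, κ, L and ‖(V₁−V₂)'‖_{L^∞(Ω)}, such that for every t ∈ [0,T]: ∫_Ω |∂_x φ^η(t,x)| dx ≤ Λ₁(∫_Ω |∂_x r(t,x)| dx + 1) and ∫_Ω |∂_x r(t,x)| dx ≤ Λ₂(∫_Ω |∂_x φ^η(t,x)| dx + 1). -/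

import Mathlib

open MeasureTheory Set

/-- Spatial partial derivative. -/
noncomputable def pdx (u : ℝ → ℝ → ℝ) : ℝ → ℝ → ℝ := fun t x => deriv (u t) x

/-- Time partial derivative. -/
noncomputable def pdt (u : ℝ → ℝ → ℝ) : ℝ → ℝ → ℝ := fun t x => deriv (fun τ => u τ x) t

/-- Joint continuity on a time-space rectangle. -/
def JointCont (S X : Set ℝ) (u : ℝ → ℝ → ℝ) : Prop :=
  ContinuousOn (fun p : ℝ × ℝ => u p.1 p.2) (S ×ˢ X)

/-- `u ∈ C(S; C²([0,L]))`. -/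
def CtC2 (S : Set ℝ) (L : ℝ) (u : ℝ → ℝ → ℝ) : Prop :=
  JointCont S (Icc 0 L) u ∧ JointCont S (Icc 0 L) (pdx u) ∧
    JointCont S (Icc 0 L) (pdx (pdx u)) ∧
    ∀ t ∈ S, ∀ x ∈ Icc 0 L, DifferentiableAt ℝ (u t) x ∧ DifferentiableAt ℝ (pdx u t) x

/-- `u ∈ C¹(S; C([0,L]))`. -/
def C1tC (S : Set ℝ) (L : ℝ) (u : ℝ → ℝ → ℝ) : Prop :=
  JointCont S (Icc 0 L) (pdt u) ∧
    ∀ t ∈ S, ∀ x ∈ Icc 0 L, DifferentiableAt ℝ (fun τ => u τ x) t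

/-- Classical solution of the viscous cross-diffusion system. -/
def IsViscousSolutionOn (η L : ℝ) (S Sint : Set ℝ) (f V1 V2 : ℝ → ℝ)
    (ρ1 ρ2 : ℝ → ℝ → ℝ) : Prop :=
  CtC2 S L ρ1 ∧ CtC2 S L ρ2 ∧ C1tC S L ρ1 ∧ C1tC S L ρ2 ∧
  (∀ t ∈ Sint, ∀ x ∈ Ioo 0 L,
    pdt ρ1 t x = η * pdx (pdx ρ1) t x +
      deriv (fun y => ρ1 t y * deriv (fun z => deriv f (ρ1 t z + ρ2 t z) + V1 z) y) x) ∧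
  (∀ t ∈ Sint, ∀ x ∈ Ioo 0 L,
    pdt ρ2 t x = η * pdx (pdx ρ2) t x +
      deriv (fun y => ρ2 t y * deriv (fun z => deriv f (ρ1 t z + ρ2 t z) + V2 z) y) x) ∧
  (∀ t ∈ Sint, ∀ x ∈ ({0, L} : Set ℝ),
    η * pdx ρ1 t x + ρ1 t x * deriv (fun z => deriv f (ρ1 t z + ρ2 t z) + V1 z) x = 0) ∧
  (∀ t ∈ Sint, ∀ x ∈ ({0, L} : Set ℝ),
    η * pdx ρ2 t x + ρ2 t x * deriv (fun z => deriv f (ρ1 t z + ρ2 t z) + V2 z) x = 0)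

/-- Aggregate density `σ = ρ₁ + ρ₂`. -/
noncomputable def sig (ρ1 ρ2 : ℝ → ℝ → ℝ) : ℝ → ℝ → ℝ := fun t x => ρ1 t x + ρ2 t x

/-- Ratio `r = ρ₁/(ρ₁+ρ₂)`. -/
noncomputable def rat (ρ1 ρ2 : ℝ → ℝ → ℝ) : ℝ → ℝ → ℝ :=
  fun t x => ρ1 t x / (ρ1 t x + ρ2 t x)

/-- The non-linearity `ξ_η`. -/
noncomputable def xiEta (f : ℝ → ℝ) (η : ℝ) (s : ℝ) : ℝ :=
  -s * Real.exp (∫ y in Ioo (0:ℝ) s, 2 * η / (y ^ 2 * deriv (deriv f) y)) *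
    ∫ y in Ioi s,
      Real.exp (-(∫ z in Ioo (0:ℝ) y, 2 * η / (z ^ 2 * deriv (deriv f) z))) *
        (1 / (y ^ 3 * deriv (deriv f) y))

/-- Hypothesis (H2). -/
def HypH2 (f : ℝ → ℝ) (α κ : ℝ) : Prop :=
  ContDiffOn ℝ 4 f (Ioi 0) ∧
  (∀ s ∈ Ioi (0:ℝ), 0 < deriv (deriv f) s) ∧
  α ∈ Ioo (0:ℝ) 1 ∧ 0 < κ ∧
  (∀ s ∈ Ioi (0:ℝ), s ^ α / (α * κ) ≤ s ^ 2 * deriv (deriv f) s) ∧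
  (∀ s ∈ Ioi (0:ℝ), |s * deriv (deriv (deriv f)) s / deriv (deriv f) s| ≤ κ)

/-- The inhomogeneity `ω`. -/
noncomputable def omg (f : ℝ → ℝ) (η : ℝ) (V1 V2 : ℝ → ℝ) (ρ1 ρ2 : ℝ → ℝ → ℝ) :
    ℝ → ℝ → ℝ :=
  fun t x => Real.exp
    (-(∫ s in (0:ℝ)..x, deriv (fun y => V1 y - V2 y) s * xiEta f η (sig ρ1 ρ2 t s)))

/-- The inhomogeneous ratio `φ^η = r ω/(1 − r + r ω)`. -/
noncomputable def phiEta (f : ℝ → ℝ) (η : ℝ) (V1 V2 : ℝ → ℝ) (ρ1 ρ2 : ℝ → ℝ → ℝ) :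
    ℝ → ℝ → ℝ :=
  fun t x => rat ρ1 ρ2 t x * omg f η V1 V2 ρ1 ρ2 t x /
    (1 - rat ρ1 ρ2 t x + rat ρ1 ρ2 t x * omg f η V1 V2 ρ1 ρ2 t x)

/-- A probability density on `(0,L)`. -/
def IsProbDensity (L : ℝ) (u : ℝ → ℝ) : Prop :=
  (∀ x ∈ Ioo 0 L, 0 ≤ u x) ∧ IntegrableOn u (Ioo 0 L) ∧ (∫ x in Ioo 0 L, u x) = 1

section
open Real
noncomputable def AA (f : ℝ → ℝ) (η : ℝ) (s : ℝ) : ℝ := ∫ y in Ioo (0:ℝ) s, 2 * η / (y ^ 2 * deriv (deriv f) y)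
noncomputable def kk (f : ℝ → ℝ) (η : ℝ) (y : ℝ) : ℝ :=
  Real.exp (-(AA f η y)) * (1 / (y ^ 3 * deriv (deriv f) y))

lemma xiEta_eq (f : ℝ → ℝ) (η s : ℝ) :
    xiEta f η s = -s * Real.exp (AA f η s) * ∫ y in Ioi s, kk f η y := rfl

lemma hh_nonneg {f : ℝ → ℝ} {α κ η : ℝ} (hf : HypH2 f α κ) (hη : 0 < η) {y : ℝ} (hy : 0 < y) :
    0 ≤ 2 * η / (y ^ 2 * deriv (deriv f) y) := by
  have := hf.2.1 y hy
  positivity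

lemma inv_bound {f : ℝ → ℝ} {α κ : ℝ} (hf : HypH2 f α κ) {y : ℝ} (hy : 0 < y) :
    1 / (y ^ 2 * deriv (deriv f) y) ≤ α * κ * y ^ (-α) := by
  obtain ⟨_, h2, ⟨hα, _⟩, hκ, h5, _⟩ := hf
  have h2 := h2 y hy
  have h5 := h5 y hy
  have hp : 0 < y ^ α := rpow_pos_of_pos hy _
  rw [rpow_neg hy.le]
  have : α * κ * (y ^ α)⁻¹ = 1 / (y ^ α / (α * κ)) := by field_simp
  rw [this]
  exact one_div_le_one_div_of_le (by positivity) h5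

lemma hh_int {f : ℝ → ℝ} {α κ η : ℝ} (hf : HypH2 f α κ) (hη : 0 < η) (s : ℝ) :
    IntegrableOn (fun y => 2 * η / (y ^ 2 * deriv (deriv f) y)) (Ioo 0 s) := by
  rcases le_or_gt s 0 with hs | hs
  · rw [Ioo_eq_empty (by linarith)]; exact integrableOn_empty
  have hI : IntegrableOn (fun y : ℝ => 2 * η * (α * κ * y ^ (-α))) (Ioo 0 s) := by
    have := intervalIntegral.intervalIntegrable_rpow' (a := 0) (b := s) (r := -α)
      (by linarith [hf.2.2.1.2])
    rw [intervalIntegrable_iff_integrableOn_Ioo_of_le hs.le] at this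
    exact (this.const_mul _).const_mul _
  refine Integrable.mono' hI ?_ ?_
  · have := measurable_deriv (deriv f)
    exact Measurable.aestronglyMeasurable (by fun_prop)
  · filter_upwards [ae_restrict_mem measurableSet_Ioo] with y hy
    rw [Real.norm_of_nonneg (hh_nonneg hf hη hy.1)]
    have := inv_bound hf hy.1
    rw [div_eq_mul_one_div]
    gcongr

lemma AA_mono {f : ℝ → ℝ} {α κ η : ℝ} (hf : HypH2 f α κ) (hη : 0 < η) : Monotone (AA f η) := by
  intro a b hab
  refine setIntegral_mono_set (hh_int hf hη b) ?_ (Ioo_subset_Ioo le_rfl hab).eventuallyLE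
  filter_upwards [ae_restrict_mem measurableSet_Ioo] with y hy
  exact hh_nonneg hf hη hy.1

lemma kk_nonneg {f : ℝ → ℝ} {α κ : ℝ} (η : ℝ) (hf : HypH2 f α κ) {y : ℝ} (hy : 0 < y) :
    0 ≤ kk f η y := by
  have := hf.2.1 y hy
  unfold kk
  positivity

lemma kk_le {f : ℝ → ℝ} {α κ η : ℝ} (hf : HypH2 f α κ) (hη : 0 < η) {s y : ℝ} (hs : 0 < s)
    (hy : s < y) : kk f η y ≤ exp (-AA f η s) * (α * κ) * y ^ (-1 - α) := by
  have hy0 : 0 < y := hs.trans hy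
  have h2 := hf.2.1 y hy0
  have e : 1 / (y ^ 3 * deriv (deriv f) y) ≤ (α * κ) * y ^ (-1 - α) := by
    have h := inv_bound hf hy0
    have : y ^ (-1 - α) = y⁻¹ * y ^ (-α) := by
      rw [sub_eq_add_neg, rpow_add hy0, rpow_neg_one]
    rw [this]
    calc 1 / (y ^ 3 * deriv (deriv f) y) = y⁻¹ * (1 / (y ^ 2 * deriv (deriv f) y)) := by
          field_simp
      _ ≤ y⁻¹ * (α * κ * y ^ (-α)) := by gcongr
      _ = _ := by ring
  unfold kk
  rw [mul_assoc]
  have := AA_mono hf hη hy.le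
  gcongr

lemma kk_int {f : ℝ → ℝ} {α κ η : ℝ} (hf : HypH2 f α κ) (hη : 0 < η) {s : ℝ} (hs : 0 < s) :
    IntegrableOn (kk f η) (Ioi s) := by
  have hI : IntegrableOn (fun y : ℝ => exp (-AA f η s) * (α * κ) * y ^ (-1 - α)) (Ioi s) :=
    (integrableOn_Ioi_rpow_of_lt (by linarith [hf.2.2.1.1]) hs).const_mul _
  refine Integrable.mono' hI ?_ ?_
  · have := measurable_deriv (deriv f)
    have := (AA_mono hf hη).measurable
    unfold kk
    exact Measurable.aestronglyMeasurable (by fun_prop)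
  · filter_upwards [ae_restrict_mem measurableSet_Ioi] with y hy
    rw [Real.norm_of_nonneg (kk_nonneg η hf (hs.trans hy))]
    exact kk_le hf hη hs hy

lemma xi_bound {f : ℝ → ℝ} {α κ η : ℝ} (hf : HypH2 f α κ) (hη : 0 < η) {s : ℝ} (hs : 0 < s) :
    |xiEta f η s| ≤ κ * (1 + s) := by
  have hα := hf.2.2.1
  have hκ := hf.2.2.2.1
  have hI : IntegrableOn (fun y : ℝ => exp (-AA f η s) * (α * κ) * y ^ (-1 - α)) (Ioi s) :=
    (integrableOn_Ioi_rpow_of_lt (by linarith [hα.1]) hs).const_mul _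
  have h1 : ∫ y in Ioi s, kk f η y ≤ exp (-AA f η s) * (κ * s ^ (-α)) := by
    calc _ ≤ ∫ y in Ioi s, exp (-AA f η s) * (α * κ) * y ^ (-1 - α) :=
          setIntegral_mono_on (kk_int hf hη hs) hI measurableSet_Ioi
            (fun y hy => kk_le hf hη hs hy)
      _ = _ := by
          rw [integral_const_mul, integral_Ioi_rpow_of_lt (by linarith [hα.1]) hs]
          have := hα.1.ne'
          have e : (-1 - α + 1) = -α := by ring
          rw [e]
          field_simp
  have h0 : 0 ≤ ∫ y in Ioi s, kk f η y :=
    setIntegral_nonneg measurableSet_Ioi (fun y hy => kk_nonneg η hf (hs.trans hy))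
  rw [xiEta_eq, abs_mul, abs_mul, abs_neg, abs_of_pos hs, abs_of_pos (exp_pos _), abs_of_nonneg h0]
  calc s * exp (AA f η s) * ∫ y in Ioi s, kk f η y
      ≤ s * exp (AA f η s) * (exp (-AA f η s) * (κ * s ^ (-α))) := by gcongr
    _ = κ * (s * s ^ (-α)) := by
        have : exp (AA f η s) * exp (-AA f η s) = 1 := by rw [← exp_add]; simp
        linear_combination (κ * (s * s ^ (-α))) * this
    _ ≤ κ * (1 + s) := by
        gcongr
        have : s * s ^ (-α) = s ^ (1 - α) := by
          rw [sub_eq_add_neg, rpow_add hs, rpow_one]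
        rw [this]
        rcases le_total s 1 with h | h
        · have := rpow_le_one hs.le h (by linarith [hα.2] : 0 ≤ 1 - α)
          linarith
        · have := rpow_le_rpow_of_exponent_le h (by linarith [hα.1] : 1 - α ≤ 1)
          rw [rpow_one] at this
          linarith

lemma xi_meas {f : ℝ → ℝ} {α κ η : ℝ} (hf : HypH2 f α κ) (hη : 0 < η) {m : ℝ} (hm : 0 < m) :
    Measurable (fun s => xiEta f η (max s m)) := by
  have h1 := (AA_mono hf hη).measurable
  have h2 : Antitone (fun s => ∫ y in Ioi (max s m), kk f η y) := by
    intro a b hab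
    have hm' : ∀ a : ℝ, 0 < max a m := fun a => lt_of_lt_of_le hm (le_max_right _ _)
    refine setIntegral_mono_set (kk_int hf hη (hm' a)) ?_
      (Ioi_subset_Ioi (max_le_max_right m hab)).eventuallyLE
    filter_upwards [ae_restrict_mem measurableSet_Ioi] with y hy
    exact kk_nonneg η hf ((hm' a).trans hy)
  have h2 := h2.measurable
  simp only [xiEta_eq]
  fun_prop
end

lemma core_cmp {L M : ℝ} (hL : 0 < L) {r g : ℝ → ℝ}
    (hr : ∀ x ∈ Ioo 0 L, DifferentiableAt ℝ r x) (hr0 : ∀ x ∈ Ioo 0 L, 0 ≤ r x ∧ r x ≤ 1)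
    (hri : IntegrableOn (deriv r) (Ioo 0 L)) (hg : IntegrableOn g (Ioo 0 L))
    (hgM : ∫ x in Ioo 0 L, |g x| ≤ M) (φ : ℝ → ℝ)
    (hφ : φ = fun x => r x * Real.exp (-(∫ s in (0:ℝ)..x, g s)) /
      (1 - r x + r x * Real.exp (-(∫ s in (0:ℝ)..x, g s)))) :
    (∫ x in Ioo 0 L, |deriv φ x|) ≤
      Real.exp (3 * M) * (1 + M) * ((∫ x in Ioo 0 L, |deriv r x|) + 1) ∧
    (∫ x in Ioo 0 L, |deriv r x|) ≤
      Real.exp (3 * M) * (1 + M) * ((∫ x in Ioo 0 L, |deriv φ x|) + 1) := by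
  have hM : 0 ≤ M := le_trans (setIntegral_nonneg measurableSet_Ioo (fun _ _ => abs_nonneg _)) hgM
  have hii : IntervalIntegrable g volume 0 L :=
    (intervalIntegrable_iff_integrableOn_Ioo_of_le hL.le).2 hg
  have hGb : ∀ x ∈ Ioo 0 L, |∫ s in (0:ℝ)..x, g s| ≤ M := by
    intro x hx
    rw [intervalIntegral.integral_of_le hx.1.le, integral_Ioc_eq_integral_Ioo]
    refine (abs_integral_le_integral_abs).trans (le_trans ?_ hgM)
    refine setIntegral_mono_set hg.abs ?_ (Ioo_subset_Ioo le_rfl hx.2.le).eventuallyLE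
    exact Filter.Eventually.of_forall (fun _ => abs_nonneg _)
  have key : ∀ᵐ x ∂(volume.restrict (Ioo 0 L)),
      |deriv φ x| ≤ Real.exp (3 * M) * (|deriv r x| + |g x|) ∧
      |deriv r x| ≤ Real.exp (3 * M) * |deriv φ x| + |g x| := by
    rw [ae_restrict_iff' measurableSet_Ioo]
    filter_upwards [hii.ae_hasDerivAt_integral] with x hx hx'
    rw [uIcc_of_le hL.le] at hx
    have h1 := hx (Ioo_subset_Icc_self hx') 0 ⟨le_rfl, hL.le⟩
    have hw := h1.neg.exp
    have hrd := (hr x hx').hasDerivAt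
    obtain ⟨h0, h01⟩ := hr0 x hx'
    have hG := abs_le.1 (hGb x hx')
    have hlo : Real.exp (-M) ≤ Real.exp (-(∫ s in (0:ℝ)..x, g s)) :=
      Real.exp_le_exp.2 (by linarith [hG.2])
    have hhi : Real.exp (-(∫ s in (0:ℝ)..x, g s)) ≤ Real.exp M :=
      Real.exp_le_exp.2 (by linarith [hG.1])
    have hE1 : 1 ≤ Real.exp M := Real.one_le_exp hM
    have hE2 : Real.exp (-M) ≤ 1 := Real.exp_le_one_iff.2 (by linarith)
    have hE : Real.exp (-M) * Real.exp M = 1 := by rw [← Real.exp_add]; simp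
    have hE3 : Real.exp (3 * M) = Real.exp M ^ 3 := by
      rw [← Real.exp_nat_mul]; norm_num
    have hem : 0 < Real.exp (-M) := Real.exp_pos _
    set w := Real.exp (-(∫ s in (0:ℝ)..x, g s)) with hwdef
    set p := Real.exp M
    set q := Real.exp (-M)
    have hD1 : q ≤ 1 - r x + r x * w := by nlinarith
    have hD2 : 1 - r x + r x * w ≤ p := by nlinarith
    have hD0 : 0 < 1 - r x + r x * w := lt_of_lt_of_le hem hD1
    have hd : HasDerivAt φ (w / (1 - r x + r x * w) ^ 2 * (deriv r x - r x * (1 - r x) * g x)) x := by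
      rw [hφ]
      convert! (hrd.mul hw).div ((hrd.const_sub 1).add (hrd.mul hw)) hD0.ne' using 1
      simp only [Pi.add_apply, Pi.mul_apply, Pi.neg_apply, ← hwdef]
      field_simp
      ring
    rw [hd.deriv, hE3]
    set D := 1 - r x + r x * w
    have hw0 : 0 < w := Real.exp_pos _
    have hp0 : 0 < p := by linarith
    have hrr : |r x * (1 - r x) * g x| ≤ |g x| := by
      rw [abs_mul, abs_of_nonneg (mul_nonneg h0 (by linarith))]
      have : r x * (1 - r x) ≤ 1 := by nlinarith
      exact mul_le_of_le_one_left (abs_nonneg _) this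
    have hc1 : w / D ^ 2 ≤ p ^ 3 := by
      rw [div_le_iff₀ (by positivity)]
      have : 1 ≤ p * D := by rw [← hE]; nlinarith
      have : 1 ≤ (p * D) ^ 2 := one_le_pow₀ this
      calc w ≤ p * 1 := by linarith
        _ ≤ p * (p * D) ^ 2 := by gcongr
        _ = _ := by ring
    have hc2 : 1 ≤ p ^ 3 * (w / D ^ 2) := by
      rw [← mul_div_assoc, le_div_iff₀ (by positivity)]
      have : 1 ≤ p * w := by rw [← hE]; nlinarith
      calc 1 * D ^ 2 ≤ p ^ 2 * 1 := by rw [one_mul, mul_one]; gcongr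
        _ ≤ p ^ 2 * (p * w) := by gcongr
        _ = _ := by ring
    have hc0 : 0 < w / D ^ 2 := by positivity
    rw [abs_mul, abs_of_pos hc0]
    have t1 : |deriv r x - r x * (1 - r x) * g x| ≤ |deriv r x| + |g x| :=
      (abs_sub _ _).trans (by linarith)
    constructor
    · gcongr
    · have t2 : |deriv r x| ≤ |deriv r x - r x * (1 - r x) * g x| + |g x| := by
        have := abs_sub_abs_le_abs_sub (deriv r x) (r x * (1 - r x) * g x)
        linarith
      have := mul_le_mul_of_nonneg_right hc2 (abs_nonneg (deriv r x - r x * (1 - r x) * g x))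
      linarith
  have hφi : IntegrableOn (deriv φ) (Ioo 0 L) := by
    refine Integrable.mono' ((hri.abs.add hg.abs).const_mul (Real.exp (3 * M)))
      (measurable_deriv φ).aestronglyMeasurable ?_
    filter_upwards [key] with x hx
    exact hx.1
  have hexp : 1 ≤ Real.exp (3 * M) := Real.one_le_exp (by linarith)
  constructor
  · have h : ∫ x in Ioo 0 L, |deriv φ x| ≤
        ∫ x in Ioo 0 L, Real.exp (3 * M) * (|deriv r x| + |g x|) :=
      setIntegral_mono_ae_restrict hφi.abs ((hri.abs.add hg.abs).const_mul _)
        (key.mono fun x hx => hx.1)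
    rw [integral_const_mul, integral_add hri.abs hg.abs] at h
    have hn : 0 ≤ ∫ x in Ioo 0 L, |deriv r x| :=
      setIntegral_nonneg measurableSet_Ioo (fun _ _ => abs_nonneg _)
    refine h.trans ?_
    rw [mul_assoc]
    gcongr
    nlinarith
  · have h : ∫ x in Ioo 0 L, |deriv r x| ≤
        ∫ x in Ioo 0 L, (Real.exp (3 * M) * |deriv φ x| + |g x|) :=
      setIntegral_mono_ae_restrict hri.abs ((hφi.abs.const_mul _).add hg.abs)
        (key.mono fun x hx => hx.2)
    rw [integral_add (hφi.abs.const_mul _) hg.abs, integral_const_mul] at h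
    have hn : 0 ≤ ∫ x in Ioo 0 L, |deriv φ x| :=
      setIntegral_nonneg measurableSet_Ioo (fun _ _ => abs_nonneg _)
    refine h.trans ?_
    have : 0 ≤ Real.exp (3 * M) * M * ∫ x in Ioo 0 L, |deriv φ x| := by positivity
    nlinarith

/-- the `L¹`-norms of `∂_x φ^η` and `∂_x r` control one another, with
constants depending only on `α`, `κ`, `L` and the Lipschitz constant of `V₁ − V₂`. -/
theorem phiEta_ratio_comparison (α κ L C : ℝ)
    (hα : α ∈ Ioo (0:ℝ) 1) (hκ : 0 < κ) (hL : 0 < L) (hC : 0 < C) :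
    ∃ Λ1 Λ2 : ℝ, 0 < Λ1 ∧ 0 < Λ2 ∧
      ∀ (T η : ℝ), 0 < T → η ∈ Ioc (0:ℝ) 1 →
      ∀ (f V1 V2 : ℝ → ℝ) (ρ1 ρ2 : ℝ → ℝ → ℝ),
        HypH2 f α κ →
        (∀ x ∈ Icc 0 L, DifferentiableAt ℝ V1 x ∧ DifferentiableAt ℝ V2 x) →
        (∀ x ∈ Icc 0 L, |deriv (fun y => V1 y - V2 y) x| ≤ C) →
        IsViscousSolutionOn η L (Icc 0 T) (Ioo 0 T) f V1 V2 ρ1 ρ2 →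
        (∀ t ∈ Icc 0 T, ∀ x ∈ Icc 0 L, 0 < sig ρ1 ρ2 t x) →
        (∀ t ∈ Icc 0 T, IsProbDensity L (ρ1 t) ∧ IsProbDensity L (ρ2 t)) →
        ∀ t ∈ Icc 0 T,
          (∫ x in Ioo 0 L, |pdx (phiEta f η V1 V2 ρ1 ρ2) t x|) ≤
            Λ1 * ((∫ x in Ioo 0 L, |pdx (rat ρ1 ρ2) t x|) + 1) ∧
          (∫ x in Ioo 0 L, |pdx (rat ρ1 ρ2) t x|) ≤
            Λ2 * ((∫ x in Ioo 0 L, |pdx (phiEta f η V1 V2 ρ1 ρ2) t x|) + 1) := by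
  have key : 0 < Real.exp (3 * (C * (κ * (L + 2)))) * (1 + C * (κ * (L + 2))) := by positivity
  refine ⟨_, _, key, key, ?_⟩
  intro T η hT hη f V1 V2 ρ1 ρ2 hf _ hV hsol hpos hprob t ht
  obtain ⟨c1, c2, -⟩ := hsol
  obtain ⟨p1, p2⟩ := hprob t ht
  have hslice : ∀ u : ℝ → ℝ → ℝ, JointCont (Icc 0 T) (Icc 0 L) u → ContinuousOn (u t) (Icc 0 L) := by
    intro u hu
    exact ContinuousOn.comp (f := fun x : ℝ => (t, x)) hu (by fun_prop) (fun x hx => ⟨ht, hx⟩)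
  have k1 := hslice _ c1.1
  have k2 := hslice _ c2.1
  have d1 := hslice _ c1.2.1
  have d2 := hslice _ c2.2.1
  have D1 := fun x hx => (c1.2.2.2 t ht x hx).1
  have D2 := fun x hx => (c2.2.2.2 t ht x hx).1
  have hpos := hpos t ht
  have hsc : ContinuousOn (sig ρ1 ρ2 t) (Icc 0 L) := k1.add k2
  have hrd : ∀ x ∈ Icc 0 L, HasDerivAt (rat ρ1 ρ2 t)
      ((pdx ρ1 t x * sig ρ1 ρ2 t x - ρ1 t x * (pdx ρ1 t x + pdx ρ2 t x)) / sig ρ1 ρ2 t x ^ 2) x := by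
    intro x hx
    exact (D1 x hx).hasDerivAt.div ((D1 x hx).hasDerivAt.add (D2 x hx).hasDerivAt) (hpos x hx).ne'
  -- lower bound for sigma
  obtain ⟨m, hm, hmσ⟩ : ∃ m : ℝ, 0 < m ∧ ∀ x ∈ Icc 0 L, m ≤ sig ρ1 ρ2 t x := by
    obtain ⟨x0, hx0, h⟩ := isCompact_Icc.exists_isMinOn (nonempty_Icc.2 hL.le) hsc
    exact ⟨_, hpos x0 hx0, fun x hx => h hx⟩
  have hσi : IntegrableOn (fun x => 1 + sig ρ1 ρ2 t x) (Ioo 0 L) :=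
    (integrableOn_const (by simp)).add (p1.2.1.add p2.2.1)
  have hbd : ∀ x ∈ Icc 0 L, |deriv (fun y => V1 y - V2 y) x * xiEta f η (sig ρ1 ρ2 t x)| ≤
      C * (κ * (1 + sig ρ1 ρ2 t x)) := by
    intro x hx
    rw [abs_mul]
    exact mul_le_mul (hV x hx) (xi_bound hf hη.1 (hpos x hx)) (abs_nonneg _) hC.le
  have hgi : IntegrableOn (fun x => deriv (fun y => V1 y - V2 y) x * xiEta f η (sig ρ1 ρ2 t x))
      (Ioo 0 L) := by
    refine Integrable.mono' ((hσi.const_mul κ).const_mul C) ?_ ?_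
    · have hs : AEMeasurable (sig ρ1 ρ2 t) (volume.restrict (Ioo 0 L)) :=
        (hsc.mono Ioo_subset_Icc_self).aemeasurable measurableSet_Ioo
      have h1 := (xi_meas hf hη.1 hm).comp_aemeasurable hs
      have h2 := ((measurable_deriv (fun y => V1 y - V2 y)).aemeasurable.mul h1).aestronglyMeasurable
      refine h2.congr ?_
      filter_upwards [ae_restrict_mem measurableSet_Ioo] with x hx
      simp [max_eq_left (hmσ x (Ioo_subset_Icc_self hx))]
    · filter_upwards [ae_restrict_mem measurableSet_Ioo] with x hx
      exact hbd x (Ioo_subset_Icc_self hx)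
  refine core_cmp hL (r := rat ρ1 ρ2 t)
    (g := fun x => deriv (fun y => V1 y - V2 y) x * xiEta f η (sig ρ1 ρ2 t x))
    (fun x hx => (hrd x (Ioo_subset_Icc_self hx)).differentiableAt) ?_ ?_ hgi ?_ _ rfl
  · intro x hx
    have a := p1.1 x hx
    have b := p2.1 x hx
    exact ⟨div_nonneg a (by linarith), div_le_one_of_le₀ (by linarith) (by linarith)⟩
  · have hc : ContinuousOn (deriv (rat ρ1 ρ2 t)) (Icc 0 L) := by
      refine ContinuousOn.congr (f := fun x => (pdx ρ1 t x * sig ρ1 ρ2 t x -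
        ρ1 t x * (pdx ρ1 t x + pdx ρ2 t x)) / sig ρ1 ρ2 t x ^ 2) ?_ (fun x hx => (hrd x hx).deriv)
      exact ((d1.mul hsc).sub (k1.mul (d1.add d2))).div (hsc.pow 2)
        (fun x hx => (pow_pos (hpos x hx) 2).ne')
    exact (hc.integrableOn_Icc).mono_set Ioo_subset_Icc_self
  · calc _ ≤ ∫ x in Ioo 0 L, C * (κ * (1 + sig ρ1 ρ2 t x)) :=
          setIntegral_mono_on hgi.abs ((hσi.const_mul κ).const_mul C) measurableSet_Ioo
            (fun x hx => hbd x (Ioo_subset_Icc_self hx))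
      _ = C * (κ * (L + 2)) := by
          rw [integral_const_mul, integral_const_mul]
          have h1 : ∫ x in Ioo 0 L, (1 + sig ρ1 ρ2 t x) =
              (∫ x in Ioo 0 L, (1:ℝ)) + ∫ x in Ioo 0 L, (ρ1 t x + ρ2 t x) :=
            integral_add (integrableOn_const (by simp)) (p1.2.1.add p2.2.1)
          rw [h1, integral_add p1.2.1 p2.2.1, p1.2.2, p2.2.2]
          simp [hL.le]
          norm_num
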